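/- arXiv:1605.05750 — 2 statements merged into one kernel-verified Lean document; each statement's English description precedes it below -/
import Mathlib

section
/- Assume a ground state of 𝓔ᵃ is strongly stable with constant c_a > 0 and |F₀| < ε_Γ so that the infinite corrector solution q_∞ exists with decay rate μ_q ∈ [0,1). Then there exists L₀ > 0 such that for every L ≥ L₀ the finite corrector problem has a solution q_L ∈ 𝒬_L (a critical point of 𝓔^Γ(·;F₀) restricted to 𝒬_L, i.e. ⟨δ𝓔^Γ(q_L;F₀), v⟩ = 0 for all v ∈ 𝒬_L) satisfying ‖q'_∞ − q'_L‖_{ℓ²} ≤ C μ_q^L for a constant C independent of L. -/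
open scoped BigOperators ENNReal
open Filter MeasureTheory

noncomputable section

/-- discrete strain: `u'_ℓ = u_{ℓ+1} - u_ℓ` -/
def du (u : ℕ → ℝ) (ℓ : ℕ) : ℝ := u (ℓ + 1) - u ℓ

/-- second difference of strains: `u''_ℓ = u'_{ℓ+1} - u'_ℓ` -/
def ddu (u : ℕ → ℝ) (ℓ : ℕ) : ℝ := du u (ℓ + 1) - du u ℓ

/-- the displacement space 𝒰 -/
def memU (u : ℕ → ℝ) : Prop := u 0 = 0 ∧ Summable (fun ℓ => (du u ℓ) ^ 2)

/-- ℓ² norm of a sequence -/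
def l2 (e : ℕ → ℝ) : ℝ := Real.sqrt (∑' ℓ, (e ℓ) ^ 2)

/-- compactly supported lattice function -/
def FinSupp (u : ℕ → ℝ) : Prop := ∃ N : ℕ, ∀ ℓ : ℕ, N ≤ ℓ → u ℓ = 0

/-- membership in the dual space 𝒰* -/
def memUstar (f : ℕ → ℝ) : Prop :=
  ∃ M : ℝ, ∀ u : ℕ → ℝ, u 0 = 0 → FinSupp u → |∑' ℓ, f ℓ * u ℓ| ≤ M * l2 (du u)

/-- the dual norm ‖f‖_{𝒰*} -/
def dualNorm (f : ℕ → ℝ) : ℝ :=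
  sInf {M : ℝ | 0 ≤ M ∧ ∀ u : ℕ → ℝ, u 0 = 0 → FinSupp u →
    |∑' ℓ, f ℓ * u ℓ| ≤ M * l2 (du u)}

/-- `g_ℓ = Σ_{k=ℓ+1}^∞ f_k`, as a limit of partial sums -/
def gOf (f : ℕ → ℝ) (ℓ : ℕ) : ℝ :=
  limUnder atTop (fun K : ℕ => ∑ k ∈ Finset.Ico (ℓ + 1) K, f k)

/-- duality pairing `⟨f, v⟩` for `v ∈ 𝒰`, extended by continuity (summation by parts) -/
def pairF (f : ℕ → ℝ) (v : ℕ → ℝ) : ℝ := ∑' ℓ, gOf f ℓ * du v ℓ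

/-- partial derivatives of the bulk site potential -/
def d1V (V : ℝ → ℝ → ℝ) (r s : ℝ) : ℝ := deriv (fun t => V t s) r
def d2V (V : ℝ → ℝ → ℝ) (r s : ℝ) : ℝ := deriv (fun t => V r t) s
def d11V (V : ℝ → ℝ → ℝ) (r s : ℝ) : ℝ := deriv (fun t => d1V V t s) r
def d12V (V : ℝ → ℝ → ℝ) (r s : ℝ) : ℝ := deriv (fun t => d1V V r t) s
def d22V (V : ℝ → ℝ → ℝ) (r s : ℝ) : ℝ := deriv (fun t => d2V V r t) s

/-- Cauchy–Born energy density `W(F) = V(F,F)` and its derivatives -/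
def Wcb (V : ℝ → ℝ → ℝ) (F : ℝ) : ℝ := V F F
def dW (V : ℝ → ℝ → ℝ) (F : ℝ) : ℝ := deriv (Wcb V) F
def d2W (V : ℝ → ℝ → ℝ) (F : ℝ) : ℝ := deriv (dW V) F

/-- standing assumptions (i)–(vi) on the site energies -/
structure SiteAssumptions (V : ℝ → ℝ → ℝ) (Vs : ℝ → ℝ) : Prop where
  smooth_V : ContDiff ℝ 3 (Function.uncurry V)
  smooth_Vs : ContDiff ℝ 3 Vs
  bdd_V : ∀ i : ℕ, i ≤ 3 → ∃ B : ℝ, ∀ p : ℝ × ℝ,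
    ‖iteratedFDeriv ℝ i (Function.uncurry V) p‖ ≤ B
  bdd_Vs : ∀ i : ℕ, i ≤ 3 → ∃ B : ℝ, ∀ x : ℝ, ‖iteratedFDeriv ℝ i Vs x‖ ≤ B
  V_zero : V 0 0 = 0
  posdef : ∀ p : ℝ × ℝ, p ≠ 0 →
    0 < d11V V 0 0 * p.1 ^ 2 + 2 * d12V V 0 0 * p.1 * p.2 + d22V V 0 0 * p.2 ^ 2
  pos_away : ∀ ε : ℝ, 0 < ε → ∃ δ : ℝ, 0 < δ ∧
    ∀ r s : ℝ, ε < Real.sqrt (r ^ 2 + s ^ 2) → δ ≤ V r s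
  surf_limit : ∀ s : ℝ, Tendsto (fun r => V r s) atTop (nhds (Vs s))

/-- atomistic energy, with values in `[0,∞]` (the site energies are nonnegative
under the standing assumptions) -/
def EaE (V : ℝ → ℝ → ℝ) (Vs : ℝ → ℝ) (u : ℕ → ℝ) : ℝ≥0∞ :=
  ENNReal.ofReal (Vs (du u 0)) +
    ∑' ℓ : ℕ, ENNReal.ofReal (V (du u ℓ) (du u (ℓ + 1)))

/-- ground state: global minimizer of the atomistic energy over 𝒰 -/
def GroundState (V : ℝ → ℝ → ℝ) (Vs : ℝ → ℝ) (u : ℕ → ℝ) : Prop :=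
  memU u ∧ ∀ w : ℕ → ℝ, memU w → EaE V Vs u ≤ EaE V Vs w

/-- first variation of 𝓔ᵃ, as a function of the strain sequence `e` -/
def fvA (V : ℝ → ℝ → ℝ) (Vs : ℝ → ℝ) (e : ℕ → ℝ) (v : ℕ → ℝ) : ℝ :=
  du v 0 * (deriv Vs (e 0) + d1V V (e 0) (e 1)) +
    ∑' ℓ : ℕ, du v (ℓ + 1) *
      (d2V V (e ℓ) (e (ℓ + 1)) + d1V V (e (ℓ + 1)) (e (ℓ + 2)))

/-- second variation (of 𝓔ᵃ, and of 𝓔^Γ) as a function of the strain sequence `e` -/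
def svA (V : ℝ → ℝ → ℝ) (Vs : ℝ → ℝ) (e : ℕ → ℝ) (v : ℕ → ℝ) : ℝ :=
  deriv (deriv Vs) (e 0) * (du v 0) ^ 2 +
    ∑' ℓ : ℕ, (d11V V (e ℓ) (e (ℓ + 1)) * (du v ℓ) ^ 2
      + 2 * d12V V (e ℓ) (e (ℓ + 1)) * du v ℓ * du v (ℓ + 1)
      + d22V V (e ℓ) (e (ℓ + 1)) * (du v (ℓ + 1)) ^ 2)

/-- a strongly stable ground state with stability constant `c` -/
def StronglyStableGS (V : ℝ → ℝ → ℝ) (Vs : ℝ → ℝ) (u : ℕ → ℝ) (c : ℝ) : Prop :=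
  GroundState V Vs u ∧ 0 < c ∧
    ∀ v : ℕ → ℝ, memU v → c * ∑' ℓ, (du v ℓ) ^ 2 ≤ svA V Vs (du u) v

/-- critical point of 𝓔ᵃ: the pointwise Euler–Lagrange equations -/
def CriticalA (V : ℝ → ℝ → ℝ) (Vs : ℝ → ℝ) (u : ℕ → ℝ) : Prop :=
  deriv Vs (du u 0) + d1V V (du u 0) (du u 1) = 0 ∧
  ∀ ℓ : ℕ, d2V V (du u ℓ) (du u (ℓ + 1)) + d1V V (du u (ℓ + 1)) (du u (ℓ + 2)) = 0

/-- first variation of the corrector energy 𝓔^Γ(·;F₀) -/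
def fvG (V : ℝ → ℝ → ℝ) (Vs : ℝ → ℝ) (F0 : ℝ) (q v : ℕ → ℝ) : ℝ :=
  du v 0 * (deriv Vs (F0 + du q 0) + d1V V (F0 + du q 0) (F0 + du q 1) - dW V F0) +
    ∑' ℓ : ℕ, du v (ℓ + 1) *
      (d2V V (F0 + du q ℓ) (F0 + du q (ℓ + 1))
        + d1V V (F0 + du q (ℓ + 1)) (F0 + du q (ℓ + 2)) - dW V F0)

/-- critical point of the corrector energy: pointwise Euler–Lagrange equations -/
def CriticalG (V : ℝ → ℝ → ℝ) (Vs : ℝ → ℝ) (F0 : ℝ) (q : ℕ → ℝ) : Prop :=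
  deriv Vs (F0 + du q 0) + d1V V (F0 + du q 0) (F0 + du q 1) - dW V F0 = 0 ∧
  ∀ ℓ : ℕ, d2V V (F0 + du q ℓ) (F0 + du q (ℓ + 1))
      + d1V V (F0 + du q (ℓ + 1)) (F0 + du q (ℓ + 2)) - dW V F0 = 0

/-- second variation of the corrector energy at `q` -/
def svG (V : ℝ → ℝ → ℝ) (Vs : ℝ → ℝ) (F0 : ℝ) (q v : ℕ → ℝ) : ℝ :=
  svA V Vs (fun ℓ => F0 + du q ℓ) v

/-- membership in 𝒬_L -/
def memQL (L : ℕ) (q : ℕ → ℝ) : Prop := memU q ∧ ∀ ℓ : ℕ, L ≤ ℓ → du q ℓ = 0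

/-- continuous piecewise affine interpolant of a lattice function -/
def fAff (f : ℕ → ℝ) (x : ℝ) : ℝ :=
  f ⌊x⌋₊ + (x - (⌊x⌋₊ : ℝ)) * (f (⌊x⌋₊ + 1) - f ⌊x⌋₊)

/-- `g̃(x) = ∫_x^∞ f(s) ds`, improper integral of the interpolant -/
def gTilde (f : ℕ → ℝ) (x : ℝ) : ℝ :=
  limUnder atTop (fun K : ℕ => ∫ t in x..(K : ℝ), fAff f t)

/-- the Cauchy–Born continuum energy of a strain field `w = ∇u`, valued in `[0,∞]` -/
def EcbE (V : ℝ → ℝ → ℝ) (w : ℝ → ℝ) : ℝ≥0∞ :=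
  ∫⁻ x in Set.Ioi (0 : ℝ), ENNReal.ofReal (Wcb V (w x))

/-- strain of the projection `Π_a u^cb`, given the gradient `w = ∇u^cb` -/
def PiA (w : ℝ → ℝ) (ℓ : ℕ) : ℝ := ∫ t in (ℓ : ℝ)..((ℓ : ℝ) + 1), w t

/-- the data of "the" strongly stable Cauchy–Born solution for the force `f`:
`w = ∇u^cb`, `w1 = ∇²u^cb`, `w2 = ∇³u^cb`, with constant `Cw` -/
def CBSolution (V : ℝ → ℝ → ℝ) (f : ℕ → ℝ) (Cw : ℝ) (w w1 w2 : ℝ → ℝ) : Prop :=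
  MemLp w 2 (volume.restrict (Set.Ioi 0)) ∧
  (∀ᵐ x ∂(volume.restrict (Set.Ioi (0 : ℝ))), dW V (w x) = gTilde f x) ∧
  (∃ ccb : ℝ, 0 < ccb ∧ ∀ vw : ℝ → ℝ, MemLp vw 2 (volume.restrict (Set.Ioi 0)) →
    ccb * ∫ x in Set.Ioi (0 : ℝ), (vw x) ^ 2 ≤
      ∫ x in Set.Ioi (0 : ℝ), d2W V (w x) * (vw x) ^ 2) ∧
  (∀ x ∈ Set.Ici (0 : ℝ), HasDerivAt w (w1 x) x) ∧
  (∀ᵐ x ∂(volume.restrict (Set.Ioi (0 : ℝ))), HasDerivAt w1 (w2 x) x) ∧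
  |w 0| ≤ Cw * dualNorm f

open scoped InnerProductSpace

section Galerkin

variable {E : Type*} [NormedAddCommGroup E] [InnerProductSpace ℝ E]

/-- A Lipschitz map that is strongly monotone on a closed ball and small at its centre has a zero
in that ball. -/
theorem exists_zero_of_stronglyMonotone [CompleteSpace E] {F : E → E} {x₀ : E} {c Λ r : ℝ}
    (hc : 0 < c) (hcΛ : c ≤ Λ) (hr : 0 ≤ r) (hlip : ∀ x y, ‖F x - F y‖ ≤ Λ * ‖x - y‖)
    (hmono : ∀ x ∈ Metric.closedBall x₀ r, ∀ y ∈ Metric.closedBall x₀ r,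
      c * ‖x - y‖ ^ 2 ≤ ⟪F x - F y, x - y⟫_ℝ)
    (hsmall : ‖F x₀‖ ≤ c * r / 2) :
    ∃ x ∈ Metric.closedBall x₀ r, F x = 0 := by
  have hΛ : 0 < Λ := hc.trans_le hcΛ
  set t : ℝ := c / Λ ^ 2 with ht
  have htpos : 0 < t := by positivity
  have htΛ : t * Λ ^ 2 = c := by rw [ht]; field_simp
  have htc : t * c ≤ 1 := by
    rw [ht, div_mul_eq_mul_div, div_le_one (by positivity)]
    nlinarith
  set κ : ℝ := 1 - t * c / 2 with hκ
  have hκ0 : 0 ≤ κ := by linarith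
  have hκ1 : κ < 1 := by have := mul_pos htpos hc; linarith
  set T : E → E := fun x => x - t • F x with hT
  have hcontr : ∀ x ∈ Metric.closedBall x₀ r, ∀ y ∈ Metric.closedBall x₀ r,
      ‖T x - T y‖ ≤ κ * ‖x - y‖ := by
    intro x hx y hy
    have hTsub : T x - T y = (x - y) - t • (F x - F y) := by
      simp only [hT, smul_sub]; abel
    have hsq : ‖T x - T y‖ ^ 2 ≤ (κ * ‖x - y‖) ^ 2 := by
      rw [hTsub, norm_sub_sq_real, norm_smul, inner_smul_right, real_inner_comm,
        Real.norm_of_nonneg htpos.le]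
      have h1 := mul_le_mul_of_nonneg_left (hmono x hx y hy) htpos.le
      have h2 : ‖F x - F y‖ ^ 2 ≤ (Λ * ‖x - y‖) ^ 2 :=
        pow_le_pow_left₀ (norm_nonneg _) (hlip x y) 2
      have h3 := mul_le_mul_of_nonneg_left h2 (sq_nonneg t)
      have h4 : t ^ 2 * (Λ * ‖x - y‖) ^ 2 = t * c * ‖x - y‖ ^ 2 := by
        rw [← htΛ]; ring
      have h5 : 0 ≤ (t * c / 2) ^ 2 * ‖x - y‖ ^ 2 := by positivity
      rw [hκ]
      nlinarith
    exact le_of_sq_le_sq hsq (by positivity)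
  have hmaps : Set.MapsTo T (Metric.closedBall x₀ r) (Metric.closedBall x₀ r) := by
    intro x hx
    have h1 := hcontr x hx x₀ (Metric.mem_closedBall_self hr)
    have hx' : ‖x - x₀‖ ≤ r := by rwa [mem_closedBall_iff_norm] at hx
    rw [mem_closedBall_iff_norm]
    have h2 : T x - x₀ = (T x - T x₀) - t • F x₀ := by simp only [hT]; abel
    have h3 : ‖t • F x₀‖ ≤ t * (c * r / 2) := by
      rw [norm_smul, Real.norm_of_nonneg htpos.le]
      exact mul_le_mul_of_nonneg_left hsmall htpos.le
    calc ‖T x - x₀‖ ≤ ‖T x - T x₀‖ + ‖t • F x₀‖ := by rw [h2]; exact norm_sub_le _ _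
      _ ≤ κ * r + t * (c * r / 2) :=
        add_le_add (h1.trans (mul_le_mul_of_nonneg_left hx' hκ0)) h3
      _ = r := by rw [hκ]; ring
  have hcw : ContractingWith ⟨κ, hκ0⟩ (hmaps.restrict T _ _) := by
    refine ⟨by exact_mod_cast hκ1, LipschitzWith.of_dist_le_mul fun x y => ?_⟩
    rw [Subtype.dist_eq, Subtype.dist_eq, dist_eq_norm, dist_eq_norm]
    exact hcontr x x.2 y y.2
  obtain ⟨x, hx, hfix, -⟩ := ContractingWith.exists_fixedPoint'
    Metric.isClosed_closedBall.isComplete hmaps hcw (Metric.mem_closedBall_self hr)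
    (edist_ne_top _ _)
  refine ⟨x, hx, ?_⟩
  have h0 : t • F x = 0 := by
    have h1 : x - t • F x = x := hfix
    simpa using h1
  exact (smul_eq_zero.mp h0).resolve_left htpos.ne'

/-- Quasi-optimal Galerkin approximation of a strongly stable zero `a` of `G` in a subspace. -/
theorem exists_galerkin_approximation (K : Submodule ℝ E) [CompleteSpace K] {G : E → E} {a b : E}
    {c Λ ρ : ℝ} (hc : 0 < c) (hcΛ : c ≤ Λ) (hlip : ∀ x y, ‖G x - G y‖ ≤ Λ * ‖x - y‖)
    (hmono : ∀ x ∈ Metric.closedBall a ρ, ∀ y ∈ Metric.closedBall a ρ,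
      c * ‖x - y‖ ^ 2 ≤ ⟪G x - G y, x - y⟫_ℝ)
    (ha : G a = 0) (hb : b ∈ K) (hab : ‖a - b‖ ≤ ρ / 2) (habΛ : Λ * ‖a - b‖ ≤ c * ρ / 4) :
    ∃ x ∈ K, (∀ w ∈ K, ⟪G x, w⟫_ℝ = 0) ∧ ‖a - x‖ ≤ (1 + Λ / c) * ‖a - b‖ := by
  have hρ : 0 ≤ ρ / 2 := (norm_nonneg _).trans hab
  have hball : ∀ x : E, ‖x - b‖ ≤ ρ / 2 → x ∈ Metric.closedBall a ρ := by
    intro x hx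
    rw [mem_closedBall_iff_norm]
    have h1 := norm_sub_le_norm_sub_add_norm_sub x b a
    rw [norm_sub_rev b a] at h1
    linarith
  have hGb : ‖G b‖ ≤ Λ * ‖a - b‖ := by
    have h1 := hlip b a
    rwa [ha, sub_zero, norm_sub_rev] at h1
  set F : K → K := fun x => K.orthogonalProjectionOnto (G x) with hF
  have hinner : ∀ x w : K, ⟪F x, w⟫_ℝ = ⟪G x, (w : E)⟫_ℝ := by
    intro x w
    rw [real_inner_comm, hF, Submodule.inner_orthogonalProjectionOnto_eq_of_mem_left,
      real_inner_comm]
  obtain ⟨x, hx, hFx⟩ := exists_zero_of_stronglyMonotone (F := F) (x₀ := ⟨b, hb⟩) (r := ρ / 2)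
    hc hcΛ hρ
    (fun x y => by
      rw [hF]
      simp only [← map_sub]
      exact (K.norm_orthogonalProjectionOnto_apply_le _).trans (hlip x y))
    (fun x hx y hy => by
      rw [mem_closedBall_iff_norm] at hx hy
      have h1 := hmono x (hball x hx) y (hball y hy)
      rw [inner_sub_left, hinner, hinner, ← inner_sub_left]
      exact h1)
    (by
      refine (K.norm_orthogonalProjectionOnto_apply_le _).trans (hGb.trans ?_)
      linarith)
  rw [mem_closedBall_iff_norm] at hx
  have horth : ∀ w ∈ K, ⟪G x, w⟫_ℝ = 0 := by
    intro w hw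
    rw [← hinner x ⟨w, hw⟩, hFx, inner_zero_left]
  refine ⟨x, x.2, horth, ?_⟩
  have h1 := hmono x (hball x hx) b (hball b (by simpa using hρ))
  rw [inner_sub_left, horth _ (K.sub_mem x.2 hb), zero_sub, ← inner_neg_left] at h1
  have h2 : c * ‖(x : E) - b‖ ^ 2 ≤ Λ * ‖a - b‖ * ‖(x : E) - b‖ := by
    refine h1.trans ((real_inner_le_norm _ _).trans ?_)
    rw [norm_neg]
    exact mul_le_mul_of_nonneg_right hGb (norm_nonneg _)
  have h3 : ‖(x : E) - b‖ ≤ Λ / c * ‖a - b‖ := by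
    rw [div_mul_eq_mul_div, le_div_iff₀ hc]
    rcases (norm_nonneg ((x : E) - b)).eq_or_lt with h0 | hpos
    · rw [← h0, zero_mul]
      exact (norm_nonneg _).trans hGb
    · exact le_of_mul_le_mul_right (by linarith [h2]) hpos
  have h4 := norm_sub_le_norm_sub_add_norm_sub a b (x : E)
  rw [norm_sub_rev b] at h4
  linarith

end Galerkin

section SmoothBounds

variable {E : Type*} [NormedAddCommGroup E] [NormedSpace ℝ E]

theorem norm_fderiv_sub_le_of_iteratedFDeriv_two_le {f : E → ℝ} {B : ℝ} (hf : ContDiff ℝ 3 f)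
    (hB : ∀ p, ‖iteratedFDeriv ℝ 2 f p‖ ≤ B) (p q : E) :
    ‖fderiv ℝ f p - fderiv ℝ f q‖ ≤ B * ‖p - q‖ := by
  have hd : ContDiff ℝ 2 (fderiv ℝ f) := hf.fderiv_right (by norm_num)
  refine convex_univ.norm_image_sub_le_of_norm_fderiv_le (𝕜 := ℝ)
    (fun x _ => (hd.differentiable (by norm_num)) x) (fun x _ => ?_) (Set.mem_univ q)
    (Set.mem_univ p)
  rw [← norm_iteratedFDeriv_one, norm_iteratedFDeriv_fderiv]
  exact hB x

theorem deriv_clm_comp_apply {Φ : E → E →L[ℝ] ℝ} {Φ' : E →L[ℝ] E →L[ℝ] ℝ} {γ : ℝ → E} {γ' : E}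
    {t : ℝ} (hΦ : HasFDerivAt Φ Φ' (γ t)) (hγ : HasDerivAt γ γ' t) (e : E) :
    deriv (fun τ => Φ (γ τ) e) t = Φ' γ' e :=
  ((hΦ.comp_hasDerivAt t hγ).clm_apply (hasDerivAt_const t e)).deriv.trans (by simp)

theorem abs_fderiv_sub_sub_fderiv_fderiv_le {f : E → ℝ} {B ρ : ℝ} (hf : ContDiff ℝ 3 f)
    (hB : ∀ p, ‖iteratedFDeriv ℝ 3 f p‖ ≤ B) {p q z : E} (hp : ‖p - z‖ ≤ ρ) (hq : ‖q - z‖ ≤ ρ) :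
    |fderiv ℝ f p (p - q) - fderiv ℝ f q (p - q) - fderiv ℝ (fderiv ℝ f) z (p - q) (p - q)| ≤
      B * ρ * ‖p - q‖ ^ 2 := by
  have hB0 : 0 ≤ B := (norm_nonneg _).trans (hB z)
  have hd : ContDiff ℝ 2 (fderiv ℝ f) := hf.fderiv_right (by norm_num)
  have hdd : ContDiff ℝ 1 (fderiv ℝ (fderiv ℝ f)) := hd.fderiv_right (by norm_num)
  have h2 : ∀ x, ‖fderiv ℝ (fderiv ℝ f) x - fderiv ℝ (fderiv ℝ f) z‖ ≤ B * ‖x - z‖ := by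
    intro x
    refine convex_univ.norm_image_sub_le_of_norm_fderiv_le (𝕜 := ℝ)
      (fun x _ => (hdd.differentiable (by norm_num)) x) (fun x _ => ?_) (Set.mem_univ z)
      (Set.mem_univ x)
    rw [← norm_iteratedFDeriv_one, norm_iteratedFDeriv_fderiv, norm_iteratedFDeriv_fderiv]
    exact hB x
  have h1 : ‖fderiv ℝ f p - fderiv ℝ f q - fderiv ℝ (fderiv ℝ f) z (p - q)‖ ≤
      B * ρ * ‖p - q‖ := by
    refine (convex_closedBall z ρ).norm_image_sub_le_of_norm_fderiv_le' (𝕜 := ℝ)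
      (fun x _ => (hd.differentiable (by norm_num)) x) (fun x hx => ?_)
      (mem_closedBall_iff_norm.2 hq) (mem_closedBall_iff_norm.2 hp)
    exact (h2 x).trans (mul_le_mul_of_nonneg_left (mem_closedBall_iff_norm.1 hx) hB0)
  have h3 := ContinuousLinearMap.le_of_opNorm_le _ h1 (p - q)
  simp only [sub_apply, Real.norm_eq_abs] at h3
  linarith [h3]

end SmoothBounds

section SitePotential

variable {V : ℝ → ℝ → ℝ} {Vs : ℝ → ℝ}

theorem d1V_eq_fderiv (hV : Differentiable ℝ (Function.uncurry V)) (r s : ℝ) :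
    d1V V r s = fderiv ℝ (Function.uncurry V) (r, s) (1, 0) := by
  have h1 : HasDerivAt (fun t : ℝ => (t, s)) (1, 0) r :=
    (hasDerivAt_id r).prodMk (hasDerivAt_const r s)
  exact ((hV (r, s)).hasFDerivAt.comp_hasDerivAt r h1).deriv

theorem d2V_eq_fderiv (hV : Differentiable ℝ (Function.uncurry V)) (r s : ℝ) :
    d2V V r s = fderiv ℝ (Function.uncurry V) (r, s) (0, 1) := by
  have h1 : HasDerivAt (fun t : ℝ => (r, t)) (0, 1) s :=
    (hasDerivAt_const s r).prodMk (hasDerivAt_id s)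
  exact ((hV (r, s)).hasFDerivAt.comp_hasDerivAt s h1).deriv

theorem fderiv_uncurry_apply (hV : Differentiable ℝ (Function.uncurry V)) (r s a b : ℝ) :
    fderiv ℝ (Function.uncurry V) (r, s) (a, b) = d1V V r s * a + d2V V r s * b := by
  have h1 : ((a, b) : ℝ × ℝ) = a • (1, 0) + b • (0, 1) := by simp
  rw [h1, map_add, map_smul, map_smul, ← d1V_eq_fderiv hV, ← d2V_eq_fderiv hV, smul_eq_mul,
    smul_eq_mul]
  ring

theorem fderiv_fderiv_uncurry_apply (hV : ContDiff ℝ 3 (Function.uncurry V)) (r s a b : ℝ) :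
    fderiv ℝ (fderiv ℝ (Function.uncurry V)) (r, s) (a, b) (a, b) =
      d11V V r s * a ^ 2 + 2 * d12V V r s * a * b + d22V V r s * b ^ 2 := by
  have hdiff : Differentiable ℝ (Function.uncurry V) := hV.differentiable (by norm_num)
  have hd : Differentiable ℝ (fderiv ℝ (Function.uncurry V)) :=
    (hV.fderiv_right (m := 2) (by norm_num)).differentiable (by norm_num)
  set A := fderiv ℝ (fderiv ℝ (Function.uncurry V)) (r, s) with hA
  have hx : HasDerivAt (fun t : ℝ => (t, s)) (1, 0) r :=
    (hasDerivAt_id r).prodMk (hasDerivAt_const r s)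
  have hy : HasDerivAt (fun t : ℝ => (r, t)) (0, 1) s :=
    (hasDerivAt_const s r).prodMk (hasDerivAt_id s)
  have h11 : d11V V r s = A (1, 0) (1, 0) := by
    simp only [d11V, d1V_eq_fderiv hdiff]
    exact deriv_clm_comp_apply (γ := fun t => (t, s)) (hd (r, s)).hasFDerivAt hx _
  have h12 : d12V V r s = A (0, 1) (1, 0) := by
    simp only [d12V, d1V_eq_fderiv hdiff]
    exact deriv_clm_comp_apply (hd (r, s)).hasFDerivAt hy _
  have h22 : d22V V r s = A (0, 1) (0, 1) := by
    simp only [d22V, d2V_eq_fderiv hdiff]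
    exact deriv_clm_comp_apply (hd (r, s)).hasFDerivAt hy _
  have hsymm : A (1, 0) (0, 1) = A (0, 1) (1, 0) :=
    second_derivative_symmetric (fun y => (hdiff y).hasFDerivAt) (hd (r, s)).hasFDerivAt _ _
  have h1 : ((a, b) : ℝ × ℝ) = a • (1, 0) + b • (0, 1) := by simp
  rw [h1, h11, h12, h22]
  simp only [map_add, map_smul, add_apply, smul_apply,
    smul_eq_mul, hsymm]
  ring

theorem norm_prod_le_abs_add_abs (a b : ℝ) : ‖((a, b) : ℝ × ℝ)‖ ≤ |a| + |b| := by
  rw [Prod.norm_def]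
  exact max_le_add_of_nonneg (abs_nonneg a) (abs_nonneg b)

theorem norm_prod_sq_le (a b : ℝ) : ‖((a, b) : ℝ × ℝ)‖ ^ 2 ≤ a ^ 2 + b ^ 2 := by
  rw [Prod.norm_def]
  rcases max_cases ‖a‖ ‖b‖ with h | h <;> rw [h.1, Real.norm_eq_abs, sq_abs] <;>
    nlinarith [sq_nonneg a, sq_nonneg b]

/-- Quantitative bounds on the site potentials used by the corrector estimates. -/
structure SiteBounds (V : ℝ → ℝ → ℝ) (Vs : ℝ → ℝ) (M : ℝ) : Prop where
  pos : 0 < M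
  d1V_lipschitz : ∀ r s r' s', |d1V V r s - d1V V r' s'| ≤ M * (|r - r'| + |s - s'|)
  d2V_lipschitz : ∀ r s r' s', |d2V V r s - d2V V r' s'| ≤ M * (|r - r'| + |s - s'|)
  surf_lipschitz : ∀ r r', |deriv Vs r - deriv Vs r'| ≤ M * |r - r'|
  bulk_monotone : ∀ {r s r' s' x y ρ : ℝ}, |r - x| ≤ ρ → |s - y| ≤ ρ → |r' - x| ≤ ρ →
    |s' - y| ≤ ρ →
    d11V V x y * (r - r') ^ 2 + 2 * d12V V x y * (r - r') * (s - s') + d22V V x y * (s - s') ^ 2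
        - M * ρ * ((r - r') ^ 2 + (s - s') ^ 2) ≤
      (d1V V r s - d1V V r' s') * (r - r') + (d2V V r s - d2V V r' s') * (s - s')
  hessian_bound : ∀ x y a b,
    |d11V V x y * a ^ 2 + 2 * d12V V x y * a * b + d22V V x y * b ^ 2| ≤ M * (a ^ 2 + b ^ 2)
  surf_monotone : ∀ {r r' x ρ : ℝ}, |r - x| ≤ ρ → |r' - x| ≤ ρ →
    deriv (deriv Vs) x * (r - r') ^ 2 - M * ρ * (r - r') ^ 2 ≤
      (deriv Vs r - deriv Vs r') * (r - r')

theorem SiteAssumptions.exists_siteBounds (h : SiteAssumptions V Vs) :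
    ∃ M, SiteBounds V Vs M := by
  obtain ⟨B₂, hB₂⟩ := h.bdd_V 2 (by norm_num)
  obtain ⟨B₃, hB₃⟩ := h.bdd_V 3 le_rfl
  obtain ⟨S₂, hS₂⟩ := h.bdd_Vs 2 (by norm_num)
  obtain ⟨S₃, hS₃⟩ := h.bdd_Vs 3 le_rfl
  have hB₂0 : 0 ≤ B₂ := (norm_nonneg _).trans (hB₂ 0)
  have hB₃0 : 0 ≤ B₃ := (norm_nonneg _).trans (hB₃ 0)
  have hS₂0 : 0 ≤ S₂ := (norm_nonneg _).trans (hS₂ 0)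
  have hS₃0 : 0 ≤ S₃ := (norm_nonneg _).trans (hS₃ 0)
  have hV : Differentiable ℝ (Function.uncurry V) := h.smooth_V.differentiable (by norm_num)
  set M := B₂ + B₃ + S₂ + S₃ + 1 with hM
  have hpartial : ∀ e : ℝ × ℝ, ‖e‖ ≤ 1 → ∀ r s r' s' : ℝ,
      |fderiv ℝ (Function.uncurry V) (r, s) e - fderiv ℝ (Function.uncurry V) (r', s') e| ≤
        M * (|r - r'| + |s - s'|) := by
    intro e he r s r' s'
    have h1 := ContinuousLinearMap.le_of_opNorm_le_of_le _
      (norm_fderiv_sub_le_of_iteratedFDeriv_two_le h.smooth_V hB₂ (r, s) (r', s')) he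
    rw [sub_apply, Real.norm_eq_abs, mul_one, Prod.mk_sub_mk] at h1
    refine h1.trans (mul_le_mul (by linarith) (norm_prod_le_abs_add_abs _ _) (norm_nonneg _)
      (by linarith))
  refine ⟨M, by linarith, ?_, ?_, ?_, ?_, ?_, ?_⟩
  · intro r s r' s'
    rw [d1V_eq_fderiv hV, d1V_eq_fderiv hV]
    exact hpartial _ (by simp [Prod.norm_def]) r s r' s'
  · intro r s r' s'
    rw [d2V_eq_fderiv hV, d2V_eq_fderiv hV]
    exact hpartial _ (by simp [Prod.norm_def]) r s r' s'
  · intro r r'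
    have h1 := ContinuousLinearMap.le_of_opNorm_le _
      (norm_fderiv_sub_le_of_iteratedFDeriv_two_le h.smooth_Vs hS₂ r r') 1
    rw [sub_apply, fderiv_apply_one_eq_deriv, fderiv_apply_one_eq_deriv,
      norm_one, mul_one, Real.norm_eq_abs, Real.norm_eq_abs] at h1
    exact h1.trans (mul_le_mul_of_nonneg_right (by linarith) (abs_nonneg _))
  · intro r s r' s' x y ρ hr hs hr' hs'
    have hρ : 0 ≤ ρ := (abs_nonneg _).trans hr
    have h1 := abs_fderiv_sub_sub_fderiv_fderiv_le h.smooth_V hB₃ (p := (r, s)) (q := (r', s'))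
      (z := (x, y)) (ρ := ρ) (by simpa [Prod.norm_def] using ⟨hr, hs⟩)
      (by simpa [Prod.norm_def] using ⟨hr', hs'⟩)
    rw [Prod.mk_sub_mk, fderiv_uncurry_apply hV, fderiv_uncurry_apply hV,
      fderiv_fderiv_uncurry_apply h.smooth_V] at h1
    have h2 : B₃ * ρ * ‖((r - r', s - s') : ℝ × ℝ)‖ ^ 2 ≤
        M * ρ * ((r - r') ^ 2 + (s - s') ^ 2) := by
      refine mul_le_mul (mul_le_mul_of_nonneg_right (by linarith) hρ) (norm_prod_sq_le _ _)
        (by positivity) (mul_nonneg (by linarith) hρ)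
    have h3 := (abs_le.1 (h1.trans h2)).1
    linarith
  · intro x y a b
    have h1 : ‖fderiv ℝ (fderiv ℝ (Function.uncurry V)) (x, y)‖ ≤ B₂ := by
      rw [← norm_iteratedFDeriv_one, norm_iteratedFDeriv_fderiv]
      exact hB₂ _
    have h2 := (fderiv ℝ (fderiv ℝ (Function.uncurry V)) (x, y)).le_opNorm₂ (a, b) (a, b)
    rw [fderiv_fderiv_uncurry_apply h.smooth_V, Real.norm_eq_abs,
      mul_assoc ‖_‖ ‖_‖ ‖_‖, ← sq] at h2
    exact h2.trans (mul_le_mul (h1.trans (by linarith)) (norm_prod_sq_le a b) (by positivity)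
      (by linarith))
  · intro r r' x ρ hr hr'
    have hρ : 0 ≤ ρ := (abs_nonneg _).trans hr
    have h1 := abs_fderiv_sub_sub_fderiv_fderiv_le h.smooth_Vs hS₃ (p := r) (q := r')
      (z := x) (ρ := ρ) hr hr'
    have hfd : ∀ u w : ℝ, fderiv ℝ Vs u w = deriv Vs u * w := fun u w => by
      rw [fderiv_eq_smul_deriv, smul_eq_mul, mul_comm]
    have hd : Differentiable ℝ (fderiv ℝ Vs) :=
      (h.smooth_Vs.fderiv_right (m := 2) (by norm_num)).differentiable (by norm_num)
    have hfdd : ∀ w : ℝ, fderiv ℝ (fderiv ℝ Vs) x w w = deriv (deriv Vs) x * w ^ 2 := fun w => by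
      have h2 : deriv Vs = fun t => fderiv ℝ Vs t 1 :=
        funext fun t => fderiv_apply_one_eq_deriv.symm
      have h3 : deriv (deriv Vs) x = fderiv ℝ (fderiv ℝ Vs) x 1 1 := by
        rw [h2]
        exact deriv_clm_comp_apply (hd x).hasFDerivAt (hasDerivAt_id x) 1
      have h4 : fderiv ℝ (fderiv ℝ Vs) x w w = fderiv ℝ (fderiv ℝ Vs) x (w • 1) (w • 1) := by
        rw [smul_eq_mul, mul_one]
      rw [h3, h4, map_smul, map_smul, smul_apply, smul_eq_mul, smul_eq_mul]
      ring
    rw [hfd, hfd, hfdd, Real.norm_eq_abs, sq_abs] at h1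
    have h2 : S₃ * ρ * (r - r') ^ 2 ≤ M * ρ * (r - r') ^ 2 :=
      mul_le_mul_of_nonneg_right (mul_le_mul_of_nonneg_right (by linarith) hρ) (sq_nonneg _)
    have h3 := (abs_le.1 (h1.trans h2)).1
    linarith

end SitePotential

section SquareSummable

open scoped lp

theorem memlp_two_iff {w : ℕ → ℝ} : Memℓp w 2 ↔ Summable fun ℓ => w ℓ ^ 2 := by
  rw [memℓp_gen_iff (by simp)]
  simp

theorem lp_summable_sq (x : ℓ²(ℕ, ℝ)) : Summable fun ℓ => x ℓ ^ 2 :=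
  memlp_two_iff.1 x.2

theorem lp_real_inner_eq_tsum (x y : ℓ²(ℕ, ℝ)) : ⟪x, y⟫_ℝ = ∑' ℓ, x ℓ * y ℓ := by
  rw [lp.inner_eq_tsum]
  exact tsum_congr fun ℓ => by rw [real_inner_eq_re_inner]; simp [mul_comm]

theorem lp_norm_sq_eq_tsum (x : ℓ²(ℕ, ℝ)) : ‖x‖ ^ 2 = ∑' ℓ, x ℓ ^ 2 := by
  rw [← real_inner_self_eq_norm_sq, lp_real_inner_eq_tsum]
  exact tsum_congr fun ℓ => (sq _).symm

theorem l2_eq_lp_norm (x : ℓ²(ℕ, ℝ)) : l2 x = ‖x‖ := by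
  rw [l2, ← lp_norm_sq_eq_tsum, Real.sqrt_sq (norm_nonneg _)]

theorem summable_mul_of_summable_sq {u w : ℕ → ℝ} (hu : Summable fun ℓ => u ℓ ^ 2)
    (hw : Summable fun ℓ => w ℓ ^ 2) : Summable fun ℓ => u ℓ * w ℓ := by
  refine Summable.of_norm_bounded (hu.add hw) fun ℓ => ?_
  rw [Real.norm_eq_abs, abs_le]
  constructor <;> nlinarith [sq_nonneg (u ℓ - w ℓ), sq_nonneg (u ℓ + w ℓ), sq_nonneg (u ℓ)]

theorem tsum_add_one_sq_le {w : ℕ → ℝ} (hw : Summable fun ℓ => w ℓ ^ 2) :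
    ∑' ℓ, w (ℓ + 1) ^ 2 ≤ ∑' ℓ, w ℓ ^ 2 := by
  rw [hw.tsum_eq_zero_add]
  exact le_add_of_nonneg_left (sq_nonneg _)

/-- Sequences supported in `{0, …, L - 1}`. -/
def stripSubmodule (L : ℕ) : Submodule ℝ ℓ²(ℕ, ℝ) where
  carrier := {x | ∀ ℓ, L ≤ ℓ → x ℓ = 0}
  add_mem' hx hy ℓ hℓ := by
    rw [lp.coeFn_add, Pi.add_apply, hx ℓ hℓ, hy ℓ hℓ, add_zero]
  zero_mem' _ _ := rfl
  smul_mem' c x hx ℓ hℓ := by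
    rw [lp.coeFn_smul, Pi.smul_apply, hx ℓ hℓ, smul_zero]

theorem isClosed_stripSubmodule (L : ℕ) : IsClosed (stripSubmodule L : Set ℓ²(ℕ, ℝ)) := by
  have h1 : (stripSubmodule L : Set ℓ²(ℕ, ℝ)) = ⋂ ℓ, ⋂ (_ : L ≤ ℓ), {x | x ℓ = 0} := by
    ext x
    simp only [Set.mem_iInter, Set.mem_ofPred_eq]
    rfl
  rw [h1]
  exact isClosed_iInter fun ℓ => isClosed_iInter fun _ =>
    isClosed_eq (lp.evalCLM ℝ (fun _ : ℕ => ℝ) 2 ℓ).continuous continuous_const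

instance (L : ℕ) : CompleteSpace (stripSubmodule L) :=
  (isClosed_stripSubmodule L).completeSpace_coe

/-- Cutting off an exponentially decaying sequence at `L` costs an error of order `μ ^ L`. -/
theorem exists_truncation {x : ℓ²(ℕ, ℝ)} {C μ : ℝ} (hC : 0 ≤ C) (hμ0 : 0 ≤ μ) (hμ1 : μ < 1)
    (hx : ∀ ℓ, |x ℓ| ≤ C * μ ^ ℓ) (L : ℕ) :
    ∃ y ∈ stripSubmodule L, ‖x - y‖ ≤ C / (1 - μ) * μ ^ L := by
  have hμ : 0 < 1 - μ := sub_pos.2 hμ1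
  have hsum : Summable fun ℓ => (if ℓ < L then x ℓ else 0) ^ 2 :=
    (lp_summable_sq x).of_nonneg_of_le (fun _ => sq_nonneg _) fun ℓ => by
      split_ifs
      · exact le_rfl
      · simpa using sq_nonneg (x ℓ)
  set y : ℓ²(ℕ, ℝ) := ⟨fun ℓ => if ℓ < L then x ℓ else 0, memlp_two_iff.2 hsum⟩ with hy
  have hyval : ∀ ℓ, y ℓ = if ℓ < L then x ℓ else 0 := fun _ => rfl
  refine ⟨y, fun ℓ hℓ => by rw [hyval, if_neg hℓ.not_gt], ?_⟩
  refine le_of_sq_le_sq ?_ (by positivity)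
  have hhead : ∑ ℓ ∈ Finset.range L, (x - y) ℓ ^ 2 = 0 :=
    Finset.sum_eq_zero fun ℓ hℓ => by
      rw [lp.coeFn_sub, Pi.sub_apply, hyval, if_pos (Finset.mem_range.1 hℓ)]
      ring
  rw [lp_norm_sq_eq_tsum, ← (lp_summable_sq (x - y)).sum_add_tsum_nat_add L, hhead, zero_add]
  have hμsq : μ ^ 2 < 1 := by nlinarith
  have hgeom : HasSum (fun ℓ => (C * μ ^ L) ^ 2 * (μ ^ 2) ^ ℓ) ((C * μ ^ L) ^ 2 * (1 - μ ^ 2)⁻¹) :=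
    (hasSum_geometric_of_lt_one (sq_nonneg μ) hμsq).mul_left _
  have htail : ∀ ℓ, (x - y) (ℓ + L) ^ 2 ≤ (C * μ ^ L) ^ 2 * (μ ^ 2) ^ ℓ := by
    intro ℓ
    rw [lp.coeFn_sub, Pi.sub_apply, hyval, if_neg (by omega), sub_zero, ← sq_abs]
    refine (pow_le_pow_left₀ (abs_nonneg _) (hx _) 2).trans_eq ?_
    ring
  calc ∑' ℓ, (x - y) (ℓ + L) ^ 2 ≤ (C * μ ^ L) ^ 2 * (1 - μ ^ 2)⁻¹ :=
        (((summable_nat_add_iff L).2 (lp_summable_sq (x - y))).tsum_le_tsum htail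
          hgeom.summable).trans_eq hgeom.tsum_eq
    _ ≤ (C * μ ^ L) ^ 2 * ((1 - μ)⁻¹) ^ 2 := by
        refine mul_le_mul_of_nonneg_left ?_ (sq_nonneg _)
        rw [inv_pow]
        exact inv_anti₀ (by positivity) (by nlinarith)
    _ = (C / (1 - μ) * μ ^ L) ^ 2 := by ring

/-- The lattice function with strain `e` vanishing at the origin. -/
def ofStrain (e : ℕ → ℝ) (ℓ : ℕ) : ℝ := ∑ i ∈ Finset.range ℓ, e i

theorem du_ofStrain (e : ℕ → ℝ) : du (ofStrain e) = e :=
  funext fun _ => Finset.sum_range_succ_sub_sum e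

theorem memU_ofStrain (x : ℓ²(ℕ, ℝ)) : memU (ofStrain x) :=
  ⟨by simp [ofStrain], by rw [du_ofStrain]; exact lp_summable_sq x⟩

end SquareSummable

section Corrector

open scoped lp

variable {V : ℝ → ℝ → ℝ} {Vs : ℝ → ℝ} {M F0 : ℝ}

/-- Coefficients of the first variation of the corrector energy at the strain `e`. -/
def strainResidual (V : ℝ → ℝ → ℝ) (Vs : ℝ → ℝ) (F0 : ℝ) (e : ℕ → ℝ) : ℕ → ℝ
  | 0 => deriv Vs (F0 + e 0) + d1V V (F0 + e 0) (F0 + e 1) - dW V F0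
  | ℓ + 1 => d2V V (F0 + e ℓ) (F0 + e (ℓ + 1)) + d1V V (F0 + e (ℓ + 1)) (F0 + e (ℓ + 2)) - dW V F0

theorem CriticalG.strainResidual_eq_zero {q : ℕ → ℝ} (hq : CriticalG V Vs F0 q) :
    ∀ ℓ, strainResidual V Vs F0 (du q) ℓ = 0
  | 0 => hq.1
  | ℓ + 1 => hq.2 ℓ

theorem fvG_eq_tsum {q v : ℕ → ℝ}
    (hs : Summable fun ℓ => du v ℓ * strainResidual V Vs F0 (du q) ℓ) :
    fvG V Vs F0 q v = ∑' ℓ, du v ℓ * strainResidual V Vs F0 (du q) ℓ :=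
  hs.tsum_eq_zero_add.symm

namespace SiteBounds

theorem strainResidual_sub_sq_le (hb : SiteBounds V Vs M) (e e' : ℕ → ℝ) (ℓ : ℕ) :
    (strainResidual V Vs F0 e ℓ - strainResidual V Vs F0 e' ℓ) ^ 2 ≤
      4 * M ^ 2 * ((e (ℓ - 1) - e' (ℓ - 1)) ^ 2 + 2 * (e ℓ - e' ℓ) ^ 2
        + (e (ℓ + 1) - e' (ℓ + 1)) ^ 2) := by
  have key : ∀ {d a b c : ℝ}, |d| ≤ M * (|a| + 2 * |b| + |c|) →
      d ^ 2 ≤ 4 * M ^ 2 * (a ^ 2 + 2 * b ^ 2 + c ^ 2) := by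
    intro d a b c hd
    rw [← sq_abs d, ← sq_abs a, ← sq_abs b, ← sq_abs c]
    have h1 := pow_le_pow_left₀ (abs_nonneg d) hd 2
    have h2 : (|a| + 2 * |b| + |c|) ^ 2 ≤ 4 * (|a| ^ 2 + 2 * |b| ^ 2 + |c| ^ 2) := by
      nlinarith [sq_nonneg (|a| - |b|), sq_nonneg (|b| - |c|), sq_nonneg (|a| - |c|)]
    have h3 := mul_le_mul_of_nonneg_left h2 (sq_nonneg M)
    rw [mul_pow] at h1
    linarith
  have habs : ∀ i, |F0 + e i - (F0 + e' i)| = |e i - e' i| := fun i => by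
    rw [add_sub_add_left_eq_sub]
  cases ℓ with
  | zero =>
    refine key ?_
    have h1 := hb.surf_lipschitz (F0 + e 0) (F0 + e' 0)
    have h2 := hb.d1V_lipschitz (F0 + e 0) (F0 + e 1) (F0 + e' 0) (F0 + e' 1)
    simp only [habs] at h1 h2
    have h3 := mul_nonneg hb.pos.le (abs_nonneg (e 0 - e' 0))
    simp only [strainResidual]
    rw [abs_le] at *
    constructor <;> simp only [Nat.zero_sub, Nat.zero_add] <;> linarith
  | succ ℓ =>
    refine key ?_
    have h1 := hb.d2V_lipschitz (F0 + e ℓ) (F0 + e (ℓ + 1)) (F0 + e' ℓ) (F0 + e' (ℓ + 1))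
    have h2 := hb.d1V_lipschitz (F0 + e (ℓ + 1)) (F0 + e (ℓ + 2)) (F0 + e' (ℓ + 1))
      (F0 + e' (ℓ + 2))
    simp only [habs] at h1 h2
    simp only [strainResidual]
    rw [abs_le] at *
    constructor <;> simp only [Nat.add_sub_cancel] <;> linarith

theorem strainResidual_sub_l2 (hb : SiteBounds V Vs M) {e e' : ℕ → ℝ}
    (he : Summable fun ℓ => (e ℓ - e' ℓ) ^ 2) :
    Summable (fun ℓ => (strainResidual V Vs F0 e ℓ - strainResidual V Vs F0 e' ℓ) ^ 2) ∧
      ∑' ℓ, (strainResidual V Vs F0 e ℓ - strainResidual V Vs F0 e' ℓ) ^ 2 ≤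
        (5 * M) ^ 2 * ∑' ℓ, (e ℓ - e' ℓ) ^ 2 := by
  set w : ℕ → ℝ := fun ℓ => e ℓ - e' ℓ with hw
  have hnext : Summable fun ℓ => w (ℓ + 1) ^ 2 := (summable_nat_add_iff 1).2 he
  have hprev : Summable fun ℓ => w (ℓ - 1) ^ 2 := by
    rw [← summable_nat_add_iff 1]
    exact he
  have hbound := ((hprev.add (he.mul_left 2)).add hnext).mul_left (4 * M ^ 2)
  have hle := hb.strainResidual_sub_sq_le (F0 := F0) e e'
  have hs := hbound.of_nonneg_of_le (fun _ => sq_nonneg _) hle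
  refine ⟨hs, (hs.tsum_le_tsum hle hbound).trans ?_⟩
  rw [tsum_mul_left, (hprev.add (he.mul_left 2)).tsum_add hnext,
    hprev.tsum_add (he.mul_left 2), tsum_mul_left, hprev.tsum_eq_zero_add]
  simp only [Nat.zero_sub, Nat.add_sub_cancel]
  have h0 : w 0 ^ 2 ≤ ∑' ℓ, w ℓ ^ 2 := he.le_tsum 0 fun _ _ => sq_nonneg _
  have h1 := tsum_add_one_sq_le he
  have h2 : w 0 ^ 2 + ∑' ℓ, w ℓ ^ 2 + 2 * ∑' ℓ, w ℓ ^ 2 + ∑' ℓ, w (ℓ + 1) ^ 2 ≤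
      5 * ∑' ℓ, w ℓ ^ 2 := by linarith
  have h3 := mul_le_mul_of_nonneg_left h2 (by positivity : 0 ≤ 4 * M ^ 2)
  have h4 : 0 ≤ M ^ 2 * ∑' ℓ, w ℓ ^ 2 := mul_nonneg (sq_nonneg M) (tsum_nonneg fun _ => sq_nonneg _)
  linarith

theorem strainResidual_monotone (hb : SiteBounds V Vs M) {a e e' : ℕ → ℝ} {ρ : ℝ}
    (he : ∀ ℓ, |e ℓ - a ℓ| ≤ ρ) (he' : ∀ ℓ, |e' ℓ - a ℓ| ≤ ρ)
    (hw : Summable fun ℓ => (e ℓ - e' ℓ) ^ 2) :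
    svA V Vs (fun ℓ => F0 + a ℓ) (ofStrain fun ℓ => e ℓ - e' ℓ)
        - 3 * M * ρ * ∑' ℓ, (e ℓ - e' ℓ) ^ 2 ≤
      ∑' ℓ, (strainResidual V Vs F0 e ℓ - strainResidual V Vs F0 e' ℓ) * (e ℓ - e' ℓ) := by
  have hρ : 0 ≤ ρ := (abs_nonneg _).trans (he 0)
  have hMρ : 0 ≤ M * ρ := mul_nonneg hb.pos.le hρ
  set w : ℕ → ℝ := fun ℓ => e ℓ - e' ℓ with hwdef
  set A : ℕ → ℝ := fun ℓ =>
    d2V V (F0 + e ℓ) (F0 + e (ℓ + 1)) - d2V V (F0 + e' ℓ) (F0 + e' (ℓ + 1)) with hA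
  set B : ℕ → ℝ := fun ℓ =>
    d1V V (F0 + e ℓ) (F0 + e (ℓ + 1)) - d1V V (F0 + e' ℓ) (F0 + e' (ℓ + 1)) with hB
  have hnext : Summable fun ℓ => w (ℓ + 1) ^ 2 := (summable_nat_add_iff 1).2 hw
  have hpair : Summable fun ℓ => w ℓ ^ 2 + w (ℓ + 1) ^ 2 := hw.add hnext
  have hshift : ∀ (u : ℕ → ℝ) i, F0 + u i - (F0 + a i) = u i - a i := fun u i =>
    add_sub_add_left_eq_sub _ _ _
  have hdiff : ∀ i, F0 + e i - (F0 + e' i) = w i := fun i => add_sub_add_left_eq_sub _ _ _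
  have hsq : ∀ {D : ℕ → ℝ}, (∀ ℓ, |D ℓ| ≤ M * (|w ℓ| + |w (ℓ + 1)|)) →
      Summable fun ℓ => D ℓ ^ 2 := by
    intro D hD
    refine (hpair.mul_left (2 * M ^ 2)).of_nonneg_of_le (fun _ => sq_nonneg _) fun ℓ => ?_
    have h1 := pow_le_pow_left₀ (abs_nonneg _) (hD ℓ) 2
    have h2 : (|w ℓ| + |w (ℓ + 1)|) ^ 2 ≤ 2 * (w ℓ ^ 2 + w (ℓ + 1) ^ 2) := by
      rw [← sq_abs (w ℓ), ← sq_abs (w (ℓ + 1))]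
      nlinarith [sq_nonneg (|w ℓ| - |w (ℓ + 1)|)]
    have h3 := mul_le_mul_of_nonneg_left h2 (sq_nonneg M)
    rw [sq_abs, mul_pow] at h1
    linarith
  have hA2 : Summable fun ℓ => A ℓ ^ 2 := hsq fun ℓ => by
    simpa only [hdiff] using hb.d2V_lipschitz (F0 + e ℓ) (F0 + e (ℓ + 1)) (F0 + e' ℓ)
      (F0 + e' (ℓ + 1))
  have hB2 : Summable fun ℓ => B ℓ ^ 2 := hsq fun ℓ => by
    simpa only [hdiff] using hb.d1V_lipschitz (F0 + e ℓ) (F0 + e (ℓ + 1)) (F0 + e' ℓ)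
      (F0 + e' (ℓ + 1))
  have hAw : Summable fun ℓ => A ℓ * w (ℓ + 1) := summable_mul_of_summable_sq hA2 hnext
  have hBw : Summable fun ℓ => B ℓ * w ℓ := summable_mul_of_summable_sq hB2 hw
  have hBw' : Summable fun ℓ => B (ℓ + 1) * w (ℓ + 1) :=
    (summable_nat_add_iff (f := fun ℓ => B ℓ * w ℓ) 1).2 hBw
  have hres := summable_mul_of_summable_sq (hb.strainResidual_sub_l2 (F0 := F0) hw).1 hw
  have hbyparts :
      ∑' ℓ, (strainResidual V Vs F0 e ℓ - strainResidual V Vs F0 e' ℓ) * w ℓ =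
        (deriv Vs (F0 + e 0) - deriv Vs (F0 + e' 0)) * w 0
          + ∑' ℓ, (B ℓ * w ℓ + A ℓ * w (ℓ + 1)) := by
    have hsucc : ∀ ℓ, (strainResidual V Vs F0 e (ℓ + 1) - strainResidual V Vs F0 e' (ℓ + 1)) *
        w (ℓ + 1) = A ℓ * w (ℓ + 1) + B (ℓ + 1) * w (ℓ + 1) := fun ℓ => by
      simp only [strainResidual, hA, hB]
      ring
    rw [hres.tsum_eq_zero_add, tsum_congr hsucc, hAw.tsum_add hBw', hBw.tsum_add hAw,
      hBw.tsum_eq_zero_add]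
    simp only [strainResidual, hB]
    ring
  have hhess : Summable fun ℓ =>
      d11V V (F0 + a ℓ) (F0 + a (ℓ + 1)) * w ℓ ^ 2
        + 2 * d12V V (F0 + a ℓ) (F0 + a (ℓ + 1)) * w ℓ * w (ℓ + 1)
        + d22V V (F0 + a ℓ) (F0 + a (ℓ + 1)) * w (ℓ + 1) ^ 2 :=
    Summable.of_norm_bounded (hpair.mul_left M) fun ℓ => hb.hessian_bound _ _ _ _
  have hbulk := (hhess.sub (hpair.mul_left (M * ρ))).tsum_le_tsum (fun ℓ => by
    have h1 := hb.bulk_monotone (r := F0 + e ℓ) (s := F0 + e (ℓ + 1)) (r' := F0 + e' ℓ)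
      (s' := F0 + e' (ℓ + 1)) (x := F0 + a ℓ) (y := F0 + a (ℓ + 1)) (ρ := ρ)
      (by rw [hshift]; exact he _) (by rw [hshift]; exact he _) (by rw [hshift]; exact he' _)
      (by rw [hshift]; exact he' _)
    simpa only [hdiff] using h1) (hBw.add hAw)
  rw [hhess.tsum_sub (hpair.mul_left (M * ρ)), tsum_mul_left, hw.tsum_add hnext] at hbulk
  have hsurf := hb.surf_monotone (r := F0 + e 0) (r' := F0 + e' 0) (x := F0 + a 0) (ρ := ρ)
    (by rw [hshift]; exact he _) (by rw [hshift]; exact he' _)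
  rw [hdiff] at hsurf
  have h0 := mul_le_mul_of_nonneg_left (hw.le_tsum 0 fun _ _ => sq_nonneg _) hMρ
  have h1 := mul_le_mul_of_nonneg_left (tsum_add_one_sq_le hw) hMρ
  rw [hbyparts, svA, du_ofStrain]
  linarith

end SiteBounds

end Corrector

open scoped lp in
/-- existence of finite-boundary-layer corrector solutions
approximating the infinite corrector solution at rate `μ_q^L`. -/
theorem existence_finite_corrector (V : ℝ → ℝ → ℝ) (Vs : ℝ → ℝ)
    (h : SiteAssumptions V Vs) (ugr : ℕ → ℝ) (ca : ℝ)
    (hgs : StronglyStableGS V Vs ugr ca)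
    (F0 : ℝ) (qinf : ℕ → ℝ) (Cq μq : ℝ)
    (hq : memU qinf) (hcrit : CriticalG V Vs F0 qinf)
    (hstab : ∀ v : ℕ → ℝ, memU v →
      ca / 2 * ∑' ℓ, (du v ℓ) ^ 2 ≤ svG V Vs F0 qinf v)
    (hCq : 0 < Cq) (hμ0 : 0 ≤ μq) (hμ1 : μq < 1)
    (hdecay : ∀ ℓ : ℕ, |du qinf ℓ| ≤ Cq * μq ^ ℓ) :
    ∃ L0 : ℕ, ∃ C : ℝ, 0 < C ∧ ∀ L : ℕ, L0 ≤ L →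
      ∃ qL : ℕ → ℝ, memQL L qL ∧
        (∀ v : ℕ → ℝ, memQL L v → fvG V Vs F0 qL v = 0) ∧
        l2 (fun ℓ => du qinf ℓ - du qL ℓ) ≤ C * μq ^ L := by
  obtain ⟨M, hb⟩ := h.exists_siteBounds
  have hM := hb.pos
  have hca : 0 < ca := hgs.2.1
  set a : ℓ²(ℕ, ℝ) := ⟨du qinf, memlp_two_iff.2 hq.2⟩ with ha
  have ha0 : ∀ ℓ, strainResidual V Vs F0 a ℓ = 0 := hcrit.strainResidual_eq_zero
  have hlip := fun x y : ℓ²(ℕ, ℝ) =>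
    hb.strainResidual_sub_l2 (F0 := F0) (e := x) (e' := y) (lp_summable_sq (x - y))
  have hmem : ∀ x : ℓ²(ℕ, ℝ), Memℓp (strainResidual V Vs F0 x) 2 := fun x =>
    memlp_two_iff.2 (by simpa only [ha0, sub_zero] using (hlip x a).1)
  set G : ℓ²(ℕ, ℝ) → ℓ²(ℕ, ℝ) := fun x => ⟨strainResidual V Vs F0 x, hmem x⟩ with hG
  set ρ : ℝ := ca / (12 * M) with hρ
  have hρpos : 0 < ρ := by positivity
  have hMρ : 3 * M * ρ = ca / 4 := by rw [hρ]; field_simp; norm_num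
  set c : ℝ := min (ca / 4) (5 * M) with hc
  have hcpos : 0 < c := lt_min (by positivity) (by positivity)
  have hGlip : ∀ x y, ‖G x - G y‖ ≤ 5 * M * ‖x - y‖ := fun x y => by
    refine le_of_sq_le_sq ?_ (by positivity)
    rw [mul_pow, lp_norm_sq_eq_tsum, lp_norm_sq_eq_tsum]
    exact (hlip x y).2
  have hGmono : ∀ x ∈ Metric.closedBall a ρ, ∀ y ∈ Metric.closedBall a ρ,
      c * ‖x - y‖ ^ 2 ≤ ⟪G x - G y, x - y⟫_ℝ := by
    intro x hx y hy
    rw [mem_closedBall_iff_norm] at hx hy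
    have hcoord : ∀ z : ℓ²(ℕ, ℝ), ‖z - a‖ ≤ ρ → ∀ ℓ, |z ℓ - a ℓ| ≤ ρ := fun z hz ℓ =>
      (lp.norm_apply_le_norm (by norm_num) (z - a) ℓ).trans hz
    have h1 := hb.strainResidual_monotone (F0 := F0) (hcoord x hx) (hcoord y hy)
      (lp_summable_sq (x - y))
    have h2 := hstab _ (memU_ofStrain (x - y))
    rw [du_ofStrain, ← lp_norm_sq_eq_tsum] at h2
    have h3 : ∑' ℓ, (x ℓ - y ℓ) ^ 2 = ‖x - y‖ ^ 2 := (lp_norm_sq_eq_tsum (x - y)).symm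
    rw [h3, hMρ] at h1
    have h4 : c * ‖x - y‖ ^ 2 ≤ ca / 4 * ‖x - y‖ ^ 2 :=
      mul_le_mul_of_nonneg_right (min_le_left _ _) (sq_nonneg _)
    rw [lp_real_inner_eq_tsum]
    refine le_trans ?_ h1
    have h5 : ca / 2 * ‖x - y‖ ^ 2 ≤
        svA V Vs (fun ℓ => F0 + a ℓ) (ofStrain fun ℓ => x ℓ - y ℓ) := h2
    linarith
  set D : ℝ := Cq / (1 - μq) with hD
  have hDpos : 0 < D := div_pos hCq (sub_pos.2 hμ1)
  have hlim : Tendsto (fun L : ℕ => D * μq ^ L) atTop (nhds 0) := by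
    simpa using (tendsto_pow_atTop_nhds_zero_of_lt_one hμ0 hμ1).const_mul D
  have hthr : 0 < min (ρ / 2) (c * ρ / 4 / (5 * M)) := by positivity
  obtain ⟨L0, hL0⟩ := eventually_atTop.1 (hlim.eventually_le_const hthr)
  refine ⟨L0, (1 + 5 * M / c) * D, by positivity, fun L hL => ?_⟩
  obtain ⟨b, hbK, hab⟩ := exists_truncation (x := a) hCq.le hμ0 hμ1 hdecay L
  have hsmall := hab.trans (hL0 L hL)
  obtain ⟨x, hxK, hx0, hxa⟩ := exists_galerkin_approximation (stripSubmodule L) hcpos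
    (min_le_right _ _) hGlip hGmono (lp.ext (funext ha0)) hbK (hsmall.trans (min_le_left _ _))
    (by
      rw [mul_comm, ← le_div_iff₀ (by positivity)]
      exact hsmall.trans (min_le_right _ _))
  refine ⟨ofStrain x, ⟨memU_ofStrain x, by rw [du_ofStrain]; exact hxK⟩, fun v hv => ?_, ?_⟩
  · set w : ℓ²(ℕ, ℝ) := ⟨du v, memlp_two_iff.2 hv.1.2⟩ with hw
    have h1 := hx0 w hv.2
    rw [real_inner_comm, lp_real_inner_eq_tsum] at h1
    have h2 := fvG_eq_tsum (V := V) (Vs := Vs) (F0 := F0) (q := ofStrain x) (v := v)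
      (by
        rw [du_ofStrain]
        exact summable_mul_of_summable_sq hv.1.2 (lp_summable_sq (G x)))
    rw [h2, du_ofStrain]
    exact h1
  · rw [du_ofStrain]
    calc l2 (fun ℓ => du qinf ℓ - x ℓ) = ‖a - x‖ := l2_eq_lp_norm (a - x)
      _ ≤ (1 + 5 * M / c) * (D * μq ^ L) :=
        hxa.trans (mul_le_mul_of_nonneg_left hab (by positivity))
      _ = (1 + 5 * M / c) * D * μq ^ L := by ring
end
end

section
/- Let f ∈ 𝒰*, let g_ℓ := Σ_{k=ℓ+1}^∞ f_k (the limit of partial sums, which exists), and let g̃(x) := ∫_x^∞ f(s) ds (improper integral of the piecewise affine interpolant of f, which exists for every x ≥ 0). Then: (a) |g_ℓ − g̃(ℓ + 1/2)| ≤ (1/8)|f_{ℓ+1} − f_ℓ| for all ℓ ∈ ℤ_{≥0}; and (b) there is a constant C > 0 such that |g̃(x)| ≤ C(|g_{ℓ−1}| + |g_ℓ| + |g_{ℓ+1}|) for all x ∈ [ℓ, ℓ+1] and ℓ ∈ ℤ_{≥0} (with the convention g_{−1} = g_0 + f_0). -/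
open scoped BigOperators ENNReal
open Filter MeasureTheory

noncomputable section

/-- Summation by parts against the partial sums of `f` and of `v`. -/
lemma sum_mul_partialSum_add (f v : ℕ → ℝ) (n : ℕ) :
    ∑ k ∈ Finset.range (n + 1), f k * ∑ j ∈ Finset.range k, v j
      + ∑ j ∈ Finset.range (n + 1), v j * ∑ k ∈ Finset.range (j + 1), f k
      = (∑ k ∈ Finset.range (n + 1), f k) * ∑ j ∈ Finset.range (n + 1), v j := by
  induction n with
  | zero => simp [mul_comm]
  | succ n ih =>
    rw [Finset.sum_range_succ _ (n + 1), Finset.sum_range_succ (fun j => v j * _) (n + 1),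
      Finset.sum_range_succ v (n + 1), Finset.sum_range_succ f (n + 1)]
    linear_combination ih

/-- The deviation of the partial sums from a suitable constant is bounded in `ℓ²` on every
initial segment. -/
lemma exists_sum_sq_partialSum_sub_le {f : ℕ → ℝ} {M : ℝ}
    (hM : ∀ u : ℕ → ℝ, u 0 = 0 → FinSupp u → |∑' ℓ, f ℓ * u ℓ| ≤ M * l2 (du u)) (n : ℕ) :
    ∃ m : ℝ, ∑ j ∈ Finset.range (n + 1), (∑ k ∈ Finset.range (j + 1), f k - m) ^ 2 ≤ M ^ 2 := by
  set P : ℕ → ℝ := fun j => ∑ k ∈ Finset.range (j + 1), f k with hP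
  set m : ℝ := (∑ j ∈ Finset.range (n + 1), P j) / (n + 1) with hm
  set v : ℕ → ℝ := fun j => P j - m with hv
  have hn : (n : ℝ) + 1 ≠ 0 := by positivity
  have hv0 : ∑ j ∈ Finset.range (n + 1), v j = 0 := by
    simp only [hv, Finset.sum_sub_distrib, Finset.sum_const, Finset.card_range, nsmul_eq_mul, hm]
    push_cast
    field_simp
    ring
  refine ⟨m, ?_⟩
  change ∑ j ∈ Finset.range (n + 1), v j ^ 2 ≤ M ^ 2
  set S := ∑ j ∈ Finset.range (n + 1), v j ^ 2 with hS
  have hS0 : 0 ≤ S := Finset.sum_nonneg fun _ _ => sq_nonneg _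
  set u : ℕ → ℝ := fun k => if k < n + 1 then ∑ j ∈ Finset.range k, v j else 0 with hu
  have hdu : ∀ j, du u j = if j < n + 1 then v j else 0 := by
    intro j
    rcases lt_trichotomy j n with h | rfl | h
    · simp [du, hu, h, h.le, Finset.sum_range_succ]
    · rw [Finset.sum_range_succ] at hv0
      simp only [du, hu, lt_self_iff_false, Nat.lt_succ_self, if_true, if_false]
      linarith
    · simp [du, hu, h.not_ge, h.not_gt]
  have hl2 : l2 (du u) = √S := by
    rw [l2, tsum_eq_sum (s := Finset.range (n + 1))]
    · congr 1
      refine Finset.sum_congr rfl fun j hj => ?_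
      rw [hdu, if_pos (Finset.mem_range.1 hj)]
    · intro j hj
      rw [hdu, if_neg (by simpa using hj)]
      simp
  have hpair : ∑' ℓ, f ℓ * u ℓ = -S := by
    rw [tsum_eq_sum (s := Finset.range (n + 1))]
    · have h1 : ∑ k ∈ Finset.range (n + 1), f k * u k
          = ∑ k ∈ Finset.range (n + 1), f k * ∑ j ∈ Finset.range k, v j :=
        Finset.sum_congr rfl fun k hk => by simp only [hu, if_pos (Finset.mem_range.1 hk)]
      have h2 := sum_mul_partialSum_add f v n
      have h3 : S = ∑ j ∈ Finset.range (n + 1), v j * P j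
          - m * ∑ j ∈ Finset.range (n + 1), v j := by
        rw [Finset.mul_sum, ← Finset.sum_sub_distrib]
        exact Finset.sum_congr rfl fun j _ => by simp only [hv]; ring
      rw [hv0] at h2 h3
      rw [h1]
      linarith
    · intro j hj
      simp only [hu, if_neg (show ¬ j < n + 1 by simpa using hj), mul_zero]
  have key := hM u (by simp [hu]) ⟨n + 1, fun j hj => by simp [hu]; omega⟩
  rw [hpair, hl2, abs_neg, abs_of_nonneg hS0] at key
  nlinarith [sq_nonneg (M - √S), Real.sq_sqrt hS0]

/-- A sequence whose initial segments are uniformly `ℓ²`-close to constants converges. -/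
lemma exists_tendsto_of_sum_sq_sub_le {P : ℕ → ℝ} {B : ℝ}
    (h : ∀ n : ℕ, ∃ m : ℝ, ∑ j ∈ Finset.range (n + 1), (P j - m) ^ 2 ≤ B) :
    ∃ s : ℝ, Tendsto P atTop (nhds s) := by
  choose m hm using h
  have hmem : ∀ n, m n ∈ Metric.closedBall (P 0) √B := by
    intro n
    rw [Metric.mem_closedBall, dist_comm, Real.dist_eq]
    refine Real.abs_le_sqrt (le_trans ?_ (hm n))
    exact Finset.single_le_sum (f := fun j => (P j - m n) ^ 2) (fun _ _ => sq_nonneg _)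
      (by simp : 0 ∈ Finset.range (n + 1))
  obtain ⟨s, -, φ, hφ, hs⟩ := (isCompact_closedBall (P 0) √B).tendsto_subseq hmem
  refine ⟨s, ?_⟩
  have hbound : ∀ n, ∑ j ∈ Finset.range n, (P j - s) ^ 2 ≤ B := by
    intro n
    have hlim : Tendsto (fun i => ∑ j ∈ Finset.range n, (P j - m (φ i)) ^ 2) atTop
        (nhds (∑ j ∈ Finset.range n, (P j - s) ^ 2)) :=
      tendsto_finsetSum _ fun j _ => (tendsto_const_nhds.sub hs).pow 2
    refine le_of_tendsto hlim ?_
    filter_upwards [eventually_ge_atTop n] with i hi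
    refine le_trans (Finset.sum_le_sum_of_subset_of_nonneg ?_ fun _ _ _ => sq_nonneg _) (hm (φ i))
    exact Finset.range_mono (by have := hφ.id_le i; simp only [id] at this; omega)
  have hsum : Summable fun j => (P j - s) ^ 2 :=
    summable_of_sum_range_le (fun _ => sq_nonneg _) hbound
  have h0 : Tendsto (fun j => |P j - s|) atTop (nhds 0) := by
    simpa [Real.sqrt_sq_eq_abs] using hsum.tendsto_atTop_zero.sqrt
  exact tendsto_sub_nhds_zero_iff.1 ((tendsto_zero_iff_abs_tendsto_zero _).2 h0)

lemma memUstar.exists_tendsto_sum {f : ℕ → ℝ} (hf : memUstar f) :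
    ∃ s : ℝ, Tendsto (fun K : ℕ => ∑ k ∈ Finset.range K, f k) atTop (nhds s) := by
  obtain ⟨M, hM⟩ := hf
  obtain ⟨s, hs⟩ := exists_tendsto_of_sum_sq_sub_le (exists_sum_sq_partialSum_sub_le hM)
  exact ⟨s, (tendsto_add_atTop_iff_nat 1).1 hs⟩

lemma fAff_eq_of_mem_Icc (f : ℕ → ℝ) {ℓ : ℕ} {x : ℝ} (hx : x ∈ Set.Icc (ℓ : ℝ) (ℓ + 1)) :
    fAff f x = f ℓ + (x - ℓ) * (f (ℓ + 1) - f ℓ) := by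
  rcases hx.2.lt_or_eq with h | h
  · have : ⌊x⌋₊ = ℓ := (Nat.floor_eq_iff (ℓ.cast_nonneg.trans hx.1)).2 ⟨hx.1, h⟩
    simp only [fAff, this]
  · have : ⌊x⌋₊ = ℓ + 1 := by rw [h]; exact_mod_cast Nat.floor_natCast (ℓ + 1)
    simp only [fAff, this]
    rw [h]
    push_cast
    ring

lemma eqOn_fAff_uIcc (f : ℕ → ℝ) {ℓ : ℕ} {x : ℝ} (hx : x ∈ Set.Icc (ℓ : ℝ) (ℓ + 1)) :
    Set.EqOn (fAff f) (fun t => f ℓ + (t - ℓ) * (f (ℓ + 1) - f ℓ)) (Set.uIcc x (ℓ + 1)) := by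
  intro t ht
  rw [Set.uIcc_of_le hx.2] at ht
  exact fAff_eq_of_mem_Icc f ⟨hx.1.trans ht.1, ht.2⟩

lemma intervalIntegrable_fAff (f : ℕ → ℝ) {ℓ : ℕ} {x : ℝ} (hx : x ∈ Set.Icc (ℓ : ℝ) (ℓ + 1)) :
    IntervalIntegrable (fAff f) volume x (ℓ + 1) :=
  ContinuousOn.intervalIntegrable <|
    (by fun_prop : Continuous fun t : ℝ => f ℓ + (t - ℓ) * (f (ℓ + 1) - f ℓ)).continuousOn.congr
      (eqOn_fAff_uIcc f hx)

lemma integral_fAff (f : ℕ → ℝ) {ℓ : ℕ} {x : ℝ} (hx : x ∈ Set.Icc (ℓ : ℝ) (ℓ + 1)) :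
    ∫ t in x..(ℓ + 1), fAff f t
      = (f ℓ + f (ℓ + 1)) / 2 - (x - ℓ) * f ℓ - (x - ℓ) ^ 2 / 2 * (f (ℓ + 1) - f ℓ) := by
  rw [intervalIntegral.integral_congr (eqOn_fAff_uIcc f hx)]
  have hderiv : ∀ t ∈ Set.uIcc x ((ℓ : ℝ) + 1),
      HasDerivAt (fun t : ℝ => (t - ℓ) * f ℓ + (t - ℓ) ^ 2 / 2 * (f (ℓ + 1) - f ℓ))
        (f ℓ + (t - ℓ) * (f (ℓ + 1) - f ℓ)) t := by
    intro t _
    have h1 : HasDerivAt (fun t : ℝ => t - ℓ) 1 t := (hasDerivAt_id t).sub_const _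
    refine ((h1.mul_const (f ℓ)).add
      (((h1.pow 2).div_const 2).mul_const (f (ℓ + 1) - f ℓ))).congr_deriv ?_
    norm_num
  rw [intervalIntegral.integral_eq_sub_of_hasDerivAt hderiv
    (Continuous.intervalIntegrable (by fun_prop) _ _)]
  ring

lemma integral_fAff_natCast (f : ℕ → ℝ) {ℓ : ℕ} {x : ℝ} (hx : x ∈ Set.Icc (ℓ : ℝ) (ℓ + 1))
    {K : ℕ} (hK : ℓ + 1 ≤ K) :
    IntervalIntegrable (fAff f) volume x K ∧
    ∫ t in x..(K : ℝ), fAff f t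
      = ∑ k ∈ Finset.range K, f k - ∑ k ∈ Finset.range (ℓ + 1), f k + f K / 2
        + f ℓ / 2 - (x - ℓ) * f ℓ - (x - ℓ) ^ 2 / 2 * (f (ℓ + 1) - f ℓ) := by
  induction K, hK using Nat.le_induction with
  | base =>
    push_cast
    refine ⟨intervalIntegrable_fAff f hx, ?_⟩
    rw [integral_fAff f hx]
    ring
  | succ K _ ih =>
    have hKmem : (K : ℝ) ∈ Set.Icc (K : ℝ) (K + 1) := by simp
    have hint := intervalIntegrable_fAff f hKmem
    push_cast
    refine ⟨ih.1.trans hint, ?_⟩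
    rw [← intervalIntegral.integral_add_adjacent_intervals ih.1 hint, ih.2,
      integral_fAff f hKmem, Finset.sum_range_succ f K]
    ring

lemma tendsto_integral_fAff {f : ℕ → ℝ} {s : ℝ}
    (hs : Tendsto (fun K : ℕ => ∑ k ∈ Finset.range K, f k) atTop (nhds s))
    {ℓ : ℕ} {x : ℝ} (hx : x ∈ Set.Icc (ℓ : ℝ) (ℓ + 1)) :
    Tendsto (fun K : ℕ => ∫ t in x..(K : ℝ), fAff f t) atTop
      (nhds (s - ∑ k ∈ Finset.range (ℓ + 1), f k
        + f ℓ / 2 - (x - ℓ) * f ℓ - (x - ℓ) ^ 2 / 2 * (f (ℓ + 1) - f ℓ))) := by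
  have hf0 : Tendsto f atTop (nhds 0) := by
    simpa [Finset.sum_range_succ] using ((tendsto_add_atTop_iff_nat 1).2 hs).sub hs
  have hlim := ((((hs.sub_const (∑ k ∈ Finset.range (ℓ + 1), f k)).add
    (hf0.div_const 2)).add_const (f ℓ / 2)).sub_const ((x - ℓ) * f ℓ)).sub_const
      ((x - ℓ) ^ 2 / 2 * (f (ℓ + 1) - f ℓ))
  rw [zero_div, add_zero] at hlim
  refine hlim.congr' ?_
  filter_upwards [eventually_ge_atTop (ℓ + 1)] with K hK
  exact (integral_fAff_natCast f hx hK).2.symm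

lemma tendsto_sum_Ico {f : ℕ → ℝ} {s : ℝ}
    (hs : Tendsto (fun K : ℕ => ∑ k ∈ Finset.range K, f k) atTop (nhds s)) (n : ℕ) :
    Tendsto (fun K : ℕ => ∑ k ∈ Finset.Ico n K, f k) atTop
      (nhds (s - ∑ k ∈ Finset.range n, f k)) := by
  refine (hs.sub_const _).congr' ?_
  filter_upwards [eventually_ge_atTop n] with K hK
  exact (Finset.sum_Ico_eq_sub f hK).symm

/-- The bound for the interpolated tail, with `a, b, c` in the roles of
`g_{ℓ-1}, g_ℓ, g_{ℓ+1}`. -/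
lemma abs_tail_le (a b c : ℝ) {t : ℝ} (ht0 : 0 ≤ t) (ht1 : t ≤ 1) :
    |b + (a - b) / 2 - t * (a - b) - t ^ 2 / 2 * ((b - c) - (a - b))|
      ≤ 2 * (|a| + |b| + |c|) := by
  have hrw : b + (a - b) / 2 - t * (a - b) - t ^ 2 / 2 * ((b - c) - (a - b))
      = ((1 - t) ^ 2 / 2) * a + (1 / 2 + t - t ^ 2) * b + (t ^ 2 / 2) * c := by ring
  have hcoef : ∀ r y : ℝ, 0 ≤ r → r ≤ 2 → |r * y| ≤ 2 * |y| := fun r y h0 h2 => by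
    rw [abs_mul, abs_of_nonneg h0]
    exact mul_le_mul_of_nonneg_right h2 (abs_nonneg y)
  rw [hrw]
  have h1 := hcoef ((1 - t) ^ 2 / 2) a (by positivity) (by nlinarith)
  have h2 := hcoef (1 / 2 + t - t ^ 2) b (by nlinarith) (by nlinarith)
  have h3 := hcoef (t ^ 2 / 2) c (by positivity) (by nlinarith)
  have h4 := abs_add_three (((1 - t) ^ 2 / 2) * a) ((1 / 2 + t - t ^ 2) * b) ((t ^ 2 / 2) * c)
  linarith

/-- comparison of the discrete sum `g_ℓ = Σ_{k>ℓ} f_k` with the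
continuous improper integral `g̃(x) = ∫ₓ^∞ f` of the piecewise affine
interpolant. -/
theorem g_gtilde_estimates (f : ℕ → ℝ) (hf : memUstar f) :
    -- the partial sums defining g converge
    (∀ ℓ : ℕ, Tendsto (fun K : ℕ => ∑ k ∈ Finset.Ico (ℓ + 1) K, f k) atTop
      (nhds (gOf f ℓ))) ∧
    -- the improper integrals defining g̃ converge
    (∀ x : ℝ, 0 ≤ x →
      Tendsto (fun K : ℕ => ∫ t in x..(K : ℝ), fAff f t) atTop
        (nhds (gTilde f x))) ∧
    -- (a)
    (∀ ℓ : ℕ, |gOf f ℓ - gTilde f ((ℓ : ℝ) + 1 / 2)| ≤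
      (1 / 8) * |f (ℓ + 1) - f ℓ|) ∧
    -- (b), with the convention g₋₁ = g₀ + f₀
    (∃ C : ℝ, 0 < C ∧ ∀ ℓ : ℕ, ∀ x ∈ Set.Icc (ℓ : ℝ) ((ℓ : ℝ) + 1),
      |gTilde f x| ≤ C * ((if ℓ = 0 then |gOf f 0 + f 0| else |gOf f (ℓ - 1)|)
        + |gOf f ℓ| + |gOf f (ℓ + 1)|)) := by
  obtain ⟨s, hs⟩ := hf.exists_tendsto_sum
  have hg : ∀ ℓ, gOf f ℓ = s - ∑ k ∈ Finset.range (ℓ + 1), f k :=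
    fun ℓ => (tendsto_sum_Ico hs (ℓ + 1)).limUnder_eq
  have hgt : ∀ (ℓ : ℕ) (x : ℝ), x ∈ Set.Icc (ℓ : ℝ) (ℓ + 1) → gTilde f x
      = gOf f ℓ + f ℓ / 2 - (x - ℓ) * f ℓ - (x - ℓ) ^ 2 / 2 * (f (ℓ + 1) - f ℓ) :=
    fun ℓ x hx => by rw [hg]; exact (tendsto_integral_fAff hs hx).limUnder_eq
  have hsucc : ∀ ℓ, f (ℓ + 1) = gOf f ℓ - gOf f (ℓ + 1) := fun ℓ => by
    rw [hg, hg, Finset.sum_range_succ f (ℓ + 1)]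
    ring
  refine ⟨fun ℓ => tendsto_nhds_limUnder ⟨_, tendsto_sum_Ico hs (ℓ + 1)⟩,
    fun x hx => tendsto_nhds_limUnder ⟨_, tendsto_integral_fAff hs
      ⟨Nat.floor_le hx, (Nat.lt_floor_add_one x).le⟩⟩, fun ℓ => ?_, 2, two_pos, fun ℓ x hx => ?_⟩
  · rw [hgt ℓ _ ⟨by linarith, by linarith⟩]
    have hrw : gOf f ℓ - (gOf f ℓ + f ℓ / 2 - ((ℓ : ℝ) + 1 / 2 - ℓ) * f ℓ
        - ((ℓ : ℝ) + 1 / 2 - ℓ) ^ 2 / 2 * (f (ℓ + 1) - f ℓ)) = 1 / 8 * (f (ℓ + 1) - f ℓ) := by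
      ring
    rw [hrw, abs_mul, abs_of_pos (by norm_num : (0 : ℝ) < 1 / 8)]
  · have ht0 : 0 ≤ x - ℓ := by linarith [hx.1]
    have ht1 : x - ℓ ≤ 1 := by linarith [hx.2]
    rw [hgt ℓ x hx, hsucc ℓ]
    rcases ℓ with _ | ℓ
    · have h := abs_tail_le (gOf f 0 + f 0) (gOf f 0) (gOf f (0 + 1)) ht0 ht1
      rw [add_sub_cancel_left] at h
      simpa using h
    · rw [hsucc ℓ, if_neg ℓ.succ_ne_zero]
      exact abs_tail_le (gOf f ℓ) _ _ ht0 ht1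
end
end
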